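/- Let G be a finite group and let C ⊆ G be a conjugacy class with |C| ≥ 2. Then for any nonempty subset S ⊆ C, there is a set H ⊆ G with |H| ≤ ⌊|C|·log|C| / |S|⌋ + 1 such that the union of the conjugates S^h over h ∈ H equals C. -/

import Mathlib

open Finset Pointwise

/-- The conjugate `S^g = {g⁻¹ s g : s ∈ S}` of a finite subset `S` of a group. -/
def finConj {G : Type*} [Group G] [DecidableEq G] (S : Finset G) (g : G) : Finset G :=
  S.image (fun s => g⁻¹ * s * g)

/-- `C` is a conjugacy class of the finite group `G`, i.e. `C = {h⁻¹ x h : h ∈ G}` for some `x`. -/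
def IsConjClassF {G : Type*} [Group G] [Fintype G] [DecidableEq G] (C : Finset G) : Prop :=
  ∃ x : G, C = Finset.univ.image (fun h : G => h⁻¹ * x * h)

theorem card_inter_finConj {G : Type*} [Group G] [DecidableEq G] (U S : Finset G) (h : G) :
    #(U ∩ finConj S h) = ∑ u ∈ U, ∑ s ∈ S, if h⁻¹ * s * h = u then 1 else 0 := by
  rw [← Finset.filter_mem_eq_inter, Finset.card_filter]
  refine Finset.sum_congr rfl fun u _ => ?_
  have e : ∀ s : G, h⁻¹ * s * h = u ↔ s = h * u * h⁻¹ := fun s => by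
    constructor
    · rintro rfl; group
    · rintro rfl; group
  simp only [finConj, Finset.mem_image, e, Finset.sum_ite_eq', exists_eq_right]

theorem mul_one_sub_div_pow_lt_one {n s : ℝ} (hs : 0 < s) (hsn : s ≤ n) :
    n * (1 - s / n) ^ (⌊n * Real.log n / s⌋₊ + 1) < 1 := by
  have hn : 0 < n := hs.trans_le hsn
  set k := ⌊n * Real.log n / s⌋₊ + 1 with hk
  have hlt : n * Real.log n / s < k := by
    rw [hk]; exact_mod_cast Nat.lt_floor_add_one _
  have hlog : Real.log n < k * (s / n) := by
    rw [div_lt_iff₀ hs] at hlt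
    rw [← mul_div_assoc, lt_div_iff₀ hn]
    linarith
  have hq : 0 ≤ 1 - s / n := by rwa [sub_nonneg, div_le_one hn]
  calc n * (1 - s / n) ^ k ≤ n * Real.exp (-(s / n)) ^ k := by
        gcongr
        exact Real.one_sub_le_exp_neg _
    _ = Real.exp (Real.log n - k * (s / n)) := by
        rw [← Real.exp_nat_mul, sub_eq_add_neg, Real.exp_add, Real.exp_log hn, mul_neg]
    _ < 1 := by rw [← Real.exp_zero]; exact Real.exp_lt_exp.2 (by linarith)

section ConjugateCover

variable {G : Type*} [Group G] [Fintype G] [DecidableEq G] {C S : Finset G}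

theorem IsConjClassF.conj_mem (hC : IsConjClassF C) {u : G} (hu : u ∈ C) (g : G) :
    g⁻¹ * u * g ∈ C := by
  obtain ⟨x, rfl⟩ := hC
  obtain ⟨h, -, rfl⟩ := Finset.mem_image.1 hu
  exact Finset.mem_image.2 ⟨h * g, Finset.mem_univ _, by group⟩

theorem IsConjClassF.exists_conj_eq (hC : IsConjClassF C) {u v : G} (hu : u ∈ C) (hv : v ∈ C) :
    ∃ g : G, g⁻¹ * u * g = v := by
  obtain ⟨x, rfl⟩ := hC
  obtain ⟨h, -, rfl⟩ := Finset.mem_image.1 hu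
  obtain ⟨k, -, rfl⟩ := Finset.mem_image.1 hv
  exact ⟨h⁻¹ * k, by group⟩

/-- Each element of a conjugacy class is reached from any other by `|G| / |C|` conjugations. -/
theorem IsConjClassF.card_conj_eq_mul_card (hC : IsConjClassF C) {s u : G}
    (hs : s ∈ C) (hu : u ∈ C) :
    #{h : G | h⁻¹ * s * h = u} * #C = Fintype.card G := by
  have hfib : Fintype.card G = ∑ v ∈ C, #{h : G | h⁻¹ * s * h = v} :=
    Finset.card_eq_sum_card_fiberwise fun h _ => hC.conj_mem hs h
  rw [hfib, mul_comm, ← smul_eq_mul, ← Finset.sum_const]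
  refine Finset.sum_congr rfl fun v hv => ?_
  obtain ⟨g, rfl⟩ := hC.exists_conj_eq hu hv
  refine Finset.card_equiv (Equiv.mulRight g) fun h => ?_
  simp only [Finset.mem_filter, Finset.mem_univ, true_and, Equiv.coe_mulRight]
  have e : (h * g)⁻¹ * s * (h * g) = g⁻¹ * (h⁻¹ * s * h) * g := by group
  rw [e, mul_left_inj, mul_right_inj]

/-- Some conjugate of `S` covers at least the average proportion of `U`. -/
theorem IsConjClassF.exists_card_mul_card_le (hC : IsConjClassF C) (hS : S ⊆ C)
    {U : Finset G} (hU : U ⊆ C) :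
    ∃ h : G, #U * #S ≤ #(U ∩ finConj S h) * #C := by
  have hsum : ∑ _h : G, #U * #S = ∑ h : G, #(U ∩ finConj S h) * #C := by
    simp_rw [← Finset.sum_mul, card_inter_finConj]
    rw [Finset.sum_comm, Finset.sum_mul, Finset.sum_mul]
    have hu : ∀ u ∈ U, (∑ h : G, ∑ s ∈ S, if h⁻¹ * s * h = u then 1 else 0) * #C =
        #S * Fintype.card G := fun u hu => by
      rw [Finset.sum_comm, Finset.sum_mul, ← smul_eq_mul, ← Finset.sum_const]
      refine Finset.sum_congr rfl fun s hs => ?_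
      rw [← Finset.card_filter, hC.card_conj_eq_mul_card (hS hs) (hU hu)]
    rw [Finset.sum_congr rfl hu]
    simp only [Finset.sum_const, smul_eq_mul, Finset.card_univ]
    ring
  obtain ⟨h, -, hh⟩ := Finset.exists_le_of_sum_le Finset.univ_nonempty hsum.le
  exact ⟨h, hh⟩

/-- Greedily chosen conjugates of `S` leave a geometrically decaying part of `C` uncovered. -/
theorem IsConjClassF.exists_card_sdiff_biUnion_le (hC : IsConjClassF C) (hS : S ⊆ C)
    (hCpos : 0 < #C) (k : ℕ) :
    ∃ H : Finset G, #H ≤ k ∧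
      (#(C \ H.biUnion fun h => finConj S h) : ℝ) ≤ #C * (1 - (#S : ℝ) / #C) ^ k := by
  have hn : (0 : ℝ) < #C := by exact_mod_cast hCpos
  have hq : 0 ≤ 1 - (#S : ℝ) / #C := by
    rw [sub_nonneg, div_le_one hn]
    exact_mod_cast Finset.card_le_card hS
  induction k with
  | zero => exact ⟨∅, by simp⟩
  | succ k ih =>
    obtain ⟨H, hH, hle⟩ := ih
    set U := C \ H.biUnion fun h => finConj S h with hUdef
    obtain ⟨g, hg⟩ := hC.exists_card_mul_card_le hS (U := U) Finset.sdiff_subset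
    refine ⟨insert g H, (Finset.card_insert_le _ _).trans (by omega), ?_⟩
    have hsd : C \ (insert g H).biUnion (fun h => finConj S h) = U \ finConj S g := by
      rw [Finset.biUnion_insert, hUdef, sdiff_sdiff_left, Finset.sup_eq_union, Finset.union_comm]
    have hcard : (#(U \ finConj S g) : ℝ) + #(U ∩ finConj S g) = #U := by
      exact_mod_cast Finset.card_sdiff_add_card_inter U (finConj S g)
    have hg' : (#U : ℝ) * (#S / #C) ≤ #(U ∩ finConj S g) := by
      rw [← mul_div_assoc, div_le_iff₀ hn]
      exact_mod_cast hg
    rw [hsd, pow_succ, ← mul_assoc]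
    calc (#(U \ finConj S g) : ℝ) ≤ #U * (1 - #S / #C) := by linarith
      _ ≤ _ := mul_le_mul_of_nonneg_right hle hq

end ConjugateCover

theorem stmt_3 {G : Type*} [Group G] [Fintype G] [DecidableEq G]
    (C : Finset G) (hC : IsConjClassF C) (hCcard : 2 ≤ C.card)
    (S : Finset G) (hS : S ⊆ C) (hSne : S.Nonempty) :
    ∃ H : Finset G,
      H.card ≤ ⌊(C.card : ℝ) * Real.log (C.card : ℝ) / (S.card : ℝ)⌋₊ + 1 ∧
      H.biUnion (fun h => finConj S h) = C := by
  have hle : (#S : ℝ) ≤ #C := by exact_mod_cast Finset.card_le_card hS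
  have hpos : (0 : ℝ) < #S := by exact_mod_cast hSne.card_pos
  obtain ⟨H, hH, hunc⟩ := hC.exists_card_sdiff_biUnion_le hS (by omega)
    (⌊(C.card : ℝ) * Real.log (C.card : ℝ) / (S.card : ℝ)⌋₊ + 1)
  refine ⟨H, hH, Finset.Subset.antisymm ?_ ?_⟩
  · refine Finset.biUnion_subset.2 fun h _ => Finset.image_subset_iff.2 fun s hs => ?_
    exact hC.conj_mem (hS hs) h
  · have hlt := hunc.trans_lt (mul_one_sub_div_pow_lt_one hpos hle)
    rw [← Finset.sdiff_eq_empty_iff_subset, ← Finset.card_eq_zero]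
    exact Nat.lt_one_iff.1 (by exact_mod_cast hlt)
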